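/- Under exactly the hypotheses of the preceding integrator-chain result (C¹ uncertainty F and C¹ bounded disturbance w with bounded derivative, continuous χ bounding ‖F‖ and ‖∇F‖, bounded u and bounded state x, scalar-input/scalar-output residual networks π_{θ_1}, …, π_{θ_{n+1}} with sector-bounded activations, the ε-scaled observer with fixed ε-independent initial values, and a symmetric positive definite P ∈ ℝ^{(n+1)×(n+1)} making R̂_πᵀ [[ÃᵀP + PÃ, −P], [−P, 0]] R̂_π + R̂_ξᵀ Ψ(n+1)ᵀ M(n+1)(λ) Ψ(n+1) R̂_ξ negative definite, where Ã is the (n+1)×(n+1) upper shift matrix and the stacked isolation matrices use T_k¹ = [1, 0, …, 0] and T_k² = 1), the extended state is also recovered: for every T > 0 and δ > 0 there exists ε₀ > 0 such that for all ε ∈ (0, ε₀) and every solution x̂^ε of the observer, |F(t, x(t), w(t)) − x̂_{n+1}^ε(t)| ≤ δ for all t ≥ T. -/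

import Mathlib

open Matrix

/-- A residual feed-forward neural network with `Lm + 1` hidden layers,
input dimension `n₀`, output dimension `m`.  `hw l` is the width of hidden layer `l+1`
(0-based: hidden layers are indexed `0, …, Lm`).  `W l` is the weight matrix feeding
hidden layer `l`, `Wout` the output weight matrix `W^{L+1}` and `Wskip` the shortcut
connection weight matrix `W^{L+2}`. -/
structure ResNet (n₀ m : ℕ) where
  Lm : ℕ
  hw : ℕ → ℕ
  W : (l : ℕ) → Matrix (Fin (hw l)) (Fin (if l = 0 then n₀ else hw (l - 1))) ℝ
  Wout : Matrix (Fin m) (Fin (hw Lm)) ℝ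
  Wskip : Matrix (Fin m) (Fin n₀) ℝ

namespace ResNet

variable {n₀ m : ℕ}

/-- dimension of layer `l` (`l = 0` is the input layer, `l = 1, …, Lm+1` the hidden layers). -/
def dim (net : ResNet n₀ m) (l : ℕ) : ℕ := if l = 0 then n₀ else net.hw (l - 1)

/-- the forward pass through the hidden layers: `hfun σ net l x` is `h^l(x)`. -/
def hfun (σ : ℝ → ℝ) (net : ResNet n₀ m) : (l : ℕ) → (Fin n₀ → ℝ) → (Fin (net.dim l) → ℝ)
  | 0, x => x
  | l + 1, x => fun i => σ ((net.W l).mulVec (hfun σ net l x) i)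

/-- the output `π(x) = W^{L+1} h^L(x) + W^{L+2} x` of the residual network. -/
def apply (σ : ℝ → ℝ) (net : ResNet n₀ m) (x : Fin n₀ → ℝ) : Fin m → ℝ :=
  net.Wout.mulVec (hfun σ net (net.Lm + 1) x) + net.Wskip.mulVec x

/-- index type for the neurons (all hidden layers stacked). -/
abbrev NIdx (net : ResNet n₀ m) : Type := Σ l : Fin (net.Lm + 1), Fin (net.hw l)

/-- the first-layer weight matrix `W^1`. -/
def W1 (net : ResNet n₀ m) : Matrix (Fin (net.hw 0)) (Fin n₀) ℝ := net.W 0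

/-- the isolation block `N_{πw} = [0 ⋯ 0 W^{L+1}]`. -/
def Npiw (net : ResNet n₀ m) : Matrix (Fin m) net.NIdx ℝ :=
  Matrix.of fun i j =>
    if h : (j.1 : ℕ) = net.Lm then net.Wout i (Fin.cast (congrArg net.hw h) j.2) else 0

/-- the isolation block `N_{ξx} = [(W^1 T)ᵀ 0 ⋯ 0]ᵀ` for an input pre-matrix `T`. -/
def Nxix (net : ResNet n₀ m) {P : Type*} (T : Matrix (Fin n₀) P ℝ) :
    Matrix net.NIdx P ℝ :=
  Matrix.of fun j i =>
    if h : (j.1 : ℕ) = 0 then (net.W1 * T) (Fin.cast (congrArg net.hw h) j.2) i else 0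

/-- the isolation block `N_{ξw}` (block `(l, l-1)` is `W^l`). -/
def Nxiw (net : ResNet n₀ m) : Matrix net.NIdx net.NIdx ℝ :=
  Matrix.of fun i j =>
    if h : (j.1 : ℕ) + 1 = (i.1 : ℕ) then
      net.W i.1 i.2 (Fin.cast (by
        rw [if_neg (by omega : ¬ ((i.1 : ℕ)) = 0)]
        exact congrArg net.hw (by omega)) j.2)
    else 0

/-- the isolation matrix `R_π = [[I, 0], [N_{πx}, N_{πw}]]` with input pre-matrix `T`. -/
def Rpi (net : ResNet n₀ m) {P : Type*} [DecidableEq P]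
    (T : Matrix (Fin n₀) P ℝ) : Matrix (P ⊕ Fin m) (P ⊕ net.NIdx) ℝ :=
  Matrix.fromBlocks 1 0 (net.Wskip * T) net.Npiw

/-- the isolation matrix `R_ξ = [[N_{ξx}, N_{ξw}], [0, I]]` with input pre-matrix `T`. -/
def Rxi (net : ResNet n₀ m) {P : Type*}
    (T : Matrix (Fin n₀) P ℝ) : Matrix (net.NIdx ⊕ net.NIdx) (P ⊕ net.NIdx) ℝ :=
  Matrix.fromBlocks (net.Nxix T) net.Nxiw 0 1

end ResNet

/-- `Ψ = [[diag β, -I], [-diag α, I]]`. -/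
def Psi {I : Type*} [DecidableEq I] (a b : I → ℝ) : Matrix (I ⊕ I) (I ⊕ I) ℝ :=
  Matrix.fromBlocks (Matrix.diagonal b) (-1) (-(Matrix.diagonal a)) 1

/-- `M(λ) = [[0, diag λ], [diag λ, 0]]`. -/
def Mmat {I : Type*} [DecidableEq I] (lam : I → ℝ) : Matrix (I ⊕ I) (I ⊕ I) ℝ :=
  Matrix.fromBlocks 0 (Matrix.diagonal lam) (Matrix.diagonal lam) 0

/-- a matrix is negative definite if its quadratic form is negative on nonzero vectors. -/
def Matrix.NegDef {I : Type*} [Fintype I] (S : Matrix I I ℝ) : Prop :=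
  ∀ x : I → ℝ, x ≠ 0 → x ⬝ᵥ S.mulVec x < 0

/-- the Euclidean norm `‖v‖₂` of a finitely indexed real vector. -/
noncomputable def norm2 {I : Type*} [Fintype I] (v : I → ℝ) : ℝ := Real.sqrt (∑ i, v i ^ 2)

/-- `σ` is sector bounded in `[a, b]`. -/
def SectorBounded (σ : ℝ → ℝ) (a b : ℝ) : Prop := ∀ s : ℝ, 0 ≤ (σ s - a * s) * (b * s - σ s)

/-- `(C, A)` is an observable pair. -/
def Observable {n p : Type*} [Fintype n] [DecidableEq n]
    (C : Matrix p n ℝ) (A : Matrix n n ℝ) : Prop :=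
  ∀ x : n → ℝ, (∀ k : ℕ, (C * A ^ k).mulVec x = 0) → x = 0

/-- a real square matrix is Hurwitz if all its complex eigenvalues have negative real part. -/
def IsHurwitz {n : ℕ} (A : Matrix (Fin n) (Fin n) ℝ) : Prop :=
  ∀ μ ∈ spectrum ℂ (A.map (Complex.ofReal)), μ.re < 0

/-- induced `∞`-norm of a matrix: maximum absolute row sum. -/
noncomputable def rowSumNorm {I J : Type*} [Fintype J] (A : Matrix I J ℝ) : ℝ :=
  ⨆ i, ∑ j, |A i j|

section StackScalar

variable {n : ℕ}

/-- stacked block `N̂_{πx}` for `n+1` scalar-input scalar-output networks with common input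
pre-matrix `ct` (each `T_k² = 1`). -/
def NpixS (nets : Fin (n + 1) → ResNet 1 1) (ct : Matrix (Fin 1) (Fin (n + 1)) ℝ) :
    Matrix (Fin (n + 1)) (Fin (n + 1)) ℝ :=
  Matrix.of fun i j => ((nets i).Wskip * ct) 0 j

/-- stacked block `N̂_{πw}` for `n+1` scalar-input scalar-output networks. -/
def NpiwS (nets : Fin (n + 1) → ResNet 1 1) :
    Matrix (Fin (n + 1)) (Σ k, (nets k).NIdx) ℝ :=
  Matrix.of fun i j =>
    if h : j.1 = i then
      (nets i).Npiw 0 (cast (congrArg (fun k => (nets k).NIdx) h) j.2)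
    else 0

/-- stacked block `N̂_{ξx}` for `n+1` scalar-input scalar-output networks. -/
def NxixS (nets : Fin (n + 1) → ResNet 1 1) (ct : Matrix (Fin 1) (Fin (n + 1)) ℝ) :
    Matrix (Σ k, (nets k).NIdx) (Fin (n + 1)) ℝ :=
  Matrix.of fun j i => ((nets j.1).Nxix ct) j.2 i

/-- stacked block `N̂_{ξw}` for `n+1` scalar-input scalar-output networks. -/
def NxiwS (nets : Fin (n + 1) → ResNet 1 1) :
    Matrix (Σ k, (nets k).NIdx) (Σ k, (nets k).NIdx) ℝ :=
  Matrix.of fun i j =>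
    if h : j.1 = i.1 then
      (nets i.1).Nxiw i.2 (cast (congrArg (fun k => (nets k).NIdx) h) j.2)
    else 0

/-- stacked isolation matrix `R̂_π` for `n+1` scalar networks. -/
def RpiS (nets : Fin (n + 1) → ResNet 1 1) (ct : Matrix (Fin 1) (Fin (n + 1)) ℝ) :
    Matrix (Fin (n + 1) ⊕ Fin (n + 1)) (Fin (n + 1) ⊕ Σ k, (nets k).NIdx) ℝ :=
  Matrix.fromBlocks 1 0 (NpixS nets ct) (NpiwS nets)

/-- stacked isolation matrix `R̂_ξ` for `n+1` scalar networks. -/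
def RxiS (nets : Fin (n + 1) → ResNet 1 1) (ct : Matrix (Fin 1) (Fin (n + 1)) ℝ) :
    Matrix ((Σ k, (nets k).NIdx) ⊕ (Σ k, (nets k).NIdx)) (Fin (n + 1) ⊕ Σ k, (nets k).NIdx) ℝ :=
  Matrix.fromBlocks (NxixS nets ct) (NxiwS nets) 0 1

/-- the `(n+1) × (n+1)` upper shift matrix `Ã`. -/
def shiftMat (n : ℕ) : Matrix (Fin (n + 1)) (Fin (n + 1)) ℝ :=
  Matrix.of fun i j => if (i : ℕ) + 1 = (j : ℕ) then 1 else 0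

/-- the row vector `c̃ = [1, 0, …, 0]`. -/
def ctilde (n : ℕ) : Matrix (Fin 1) (Fin (n + 1)) ℝ :=
  Matrix.of fun _ j => if j = 0 then 1 else 0

end StackScalar


theorem aux_negdef {I : Type*} [Fintype I] (S : Matrix I I ℝ) (h : Matrix.NegDef S) :
    ∃ c : ℝ, 0 < c ∧ ∀ z : I → ℝ, z ⬝ᵥ S.mulVec z ≤ -c * (z ⬝ᵥ z) := by
  classical
  have hcont : Continuous (fun z : I → ℝ => z ⬝ᵥ S.mulVec z) := by
    unfold dotProduct Matrix.mulVec dotProduct; fun_prop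
  have hcont2 : Continuous (fun z : I → ℝ => z ⬝ᵥ z) := by
    unfold dotProduct; fun_prop
  have hcomp : IsCompact {z : I → ℝ | z ⬝ᵥ z = 1} := by
    apply Metric.isCompact_of_isClosed_isBounded
    · exact isClosed_eq hcont2 continuous_const
    · refine (Metric.isBounded_closedBall (x := (0 : I → ℝ)) (r := 1)).subset ?_
      intro z hz
      rw [mem_closedBall_zero_iff, pi_norm_le_iff_of_nonneg zero_le_one]
      intro i
      have h1 : z i * z i ≤ z ⬝ᵥ z :=
        Finset.single_le_sum (f := fun i => z i * z i) (fun j _ => mul_self_nonneg _)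
          (Finset.mem_univ i)
      rw [hz.out] at h1
      rw [Real.norm_eq_abs]
      exact abs_le_of_sq_le_sq (by rw [pow_two]; linarith) zero_le_one
  by_cases hne : {z : I → ℝ | z ⬝ᵥ z = 1}.Nonempty
  · obtain ⟨z0, hz0, hmax⟩ := hcomp.exists_isMaxOn hne hcont.continuousOn
    have hz0' : z0 ≠ 0 := by
      rintro rfl
      simp at hz0
    refine ⟨-(z0 ⬝ᵥ S.mulVec z0), by linarith [h z0 hz0'], ?_⟩
    intro z
    by_cases hz : z = 0
    · subst hz; simp
    have hp : 0 < z ⬝ᵥ z := by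
      have h0 : 0 ≤ z ⬝ᵥ z := Finset.sum_nonneg (fun j _ => mul_self_nonneg _)
      rcases h0.lt_or_eq with h1 | h1
      · exact h1
      · exact absurd (dotProduct_self_eq_zero.mp h1.symm) hz
    set r := Real.sqrt (z ⬝ᵥ z) with hr
    have hr2 : r * r = z ⬝ᵥ z := Real.mul_self_sqrt hp.le
    have hr0 : 0 < r := Real.sqrt_pos.mpr hp
    have hm := hmax (a := r⁻¹ • z) (by
      simp only [Set.mem_ofPred_eq, smul_dotProduct, dotProduct_smul, smul_eq_mul, ← hr2]
      field_simp)
    simp only [Set.mem_ofPred_eq, Matrix.mulVec_smul, smul_dotProduct, dotProduct_smul, smul_eq_mul] at hm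
    have : z ⬝ᵥ S.mulVec z = (r * r) * (r⁻¹ * (r⁻¹ * (z ⬝ᵥ S.mulVec z))) := by
      field_simp
    rw [this, ← hr2, neg_neg, mul_comm _ (r * r)]
    exact mul_le_mul_of_nonneg_left hm (by positivity)
  · refine ⟨1, one_pos, fun z => ?_⟩
    have hz : z = 0 := by
      by_contra hz
      apply hne
      have hp : 0 < z ⬝ᵥ z := by
        have h0 : 0 ≤ z ⬝ᵥ z := Finset.sum_nonneg (fun j _ => mul_self_nonneg _)
        rcases h0.lt_or_eq with h1 | h1
        · exact h1
        · exact absurd (dotProduct_self_eq_zero.mp h1.symm) hz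
      have hr2 : Real.sqrt (z ⬝ᵥ z) * Real.sqrt (z ⬝ᵥ z) = z ⬝ᵥ z := Real.mul_self_sqrt hp.le
      have hr0 : 0 < Real.sqrt (z ⬝ᵥ z) := Real.sqrt_pos.mpr hp
      refine ⟨(Real.sqrt (z ⬝ᵥ z))⁻¹ • z, ?_⟩
      simp only [Set.mem_ofPred_eq, smul_dotProduct, dotProduct_smul, smul_eq_mul]
      rw [← mul_assoc, ← mul_inv, hr2, inv_mul_cancel₀ hp.ne']
    subst hz; simp

theorem aux_upper {I : Type*} [Fintype I] (S : Matrix I I ℝ) :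
    ∃ c : ℝ, 0 < c ∧ ∀ z : I → ℝ, z ⬝ᵥ S.mulVec z ≤ c * (z ⬝ᵥ z) := by
  refine ⟨1 + ∑ i, ∑ j, |S i j|, by positivity, fun z => ?_⟩
  have h0 : 0 ≤ z ⬝ᵥ z := Finset.sum_nonneg (fun j _ => mul_self_nonneg _)
  have hi : ∀ i, z i * z i ≤ z ⬝ᵥ z := fun i =>
    Finset.single_le_sum (f := fun i => z i * z i) (fun j _ => mul_self_nonneg _)
          (Finset.mem_univ i)
  have : z ⬝ᵥ S.mulVec z ≤ (∑ i, ∑ j, |S i j|) * (z ⬝ᵥ z) := by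
    have hL : z ⬝ᵥ S.mulVec z = ∑ i, ∑ j, z i * (S i j * z j) := by
      simp only [dotProduct, Matrix.mulVec, Finset.mul_sum]
    rw [hL, Finset.sum_mul]
    refine Finset.sum_le_sum fun i _ => ?_
    rw [Finset.sum_mul]
    refine Finset.sum_le_sum fun j _ => ?_
    have h1 : |z i * z j| ≤ z ⬝ᵥ z := by
      rw [abs_le]; constructor <;> nlinarith [hi i, hi j, sq_nonneg (z i + z j), sq_nonneg (z i - z j)]
    calc z i * (S i j * z j) = S i j * (z i * z j) := by ring
      _ ≤ |S i j * (z i * z j)| := le_abs_self _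
      _ = |S i j| * |z i * z j| := abs_mul _ _
      _ ≤ |S i j| * (z ⬝ᵥ z) := by gcongr
  linarith

theorem aux_gronwall (V V' : ℝ → ℝ) (a K : ℝ) (ha : 0 < a)
    (hV : ∀ t, 0 ≤ t → HasDerivAt V (V' t) t)
    (hle : ∀ t, 0 ≤ t → V' t ≤ -a * V t + K) (hK : 0 ≤ K) :
    ∀ t, 0 ≤ t → V t ≤ V 0 * Real.exp (-(a * t)) + K / a := by
  intro t ht
  have hd : ∀ s, 0 ≤ s → HasDerivAt (fun s => (V s - K / a) * Real.exp (a * s))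
      (V' s * Real.exp (a * s) + (V s - K / a) * (Real.exp (a * s) * (a * 1))) s := by
    intro s hs
    exact ((hV s hs).sub_const _).mul (((hasDerivAt_id s).const_mul a).exp)
  have hanti : AntitoneOn (fun s => (V s - K / a) * Real.exp (a * s)) (Set.Ici 0) := by
    apply antitoneOn_of_deriv_nonpos (convex_Ici 0)
    · exact fun s hs => (hd s hs).continuousAt.continuousWithinAt
    · intro s hs
      rw [interior_Ici] at hs
      exact (hd s (le_of_lt hs)).differentiableAt.differentiableWithinAt
    · intro s hs
      rw [interior_Ici] at hs
      rw [(hd s (le_of_lt hs)).deriv]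
      have h1 := hle s (le_of_lt hs)
      have h2 : V' s * Real.exp (a * s) + (V s - K / a) * (Real.exp (a * s) * (a * 1))
        = (V' s + a * V s - K) * Real.exp (a * s) := by field_simp; ring
      rw [h2]
      exact mul_nonpos_of_nonpos_of_nonneg (by linarith) (Real.exp_pos _).le
  have h := hanti (Set.mem_Ici.mpr le_rfl) (Set.mem_Ici.mpr ht) ht
  simp only [mul_zero, Real.exp_zero, mul_one] at h
  have h3 : V t - K / a ≤ (V 0 - K / a) * Real.exp (-(a * t)) := by
    rw [Real.exp_neg, ← div_eq_mul_inv, le_div_iff₀ (Real.exp_pos _)]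
    exact h
  have h4 : 0 ≤ K / a * Real.exp (-(a * t)) := by positivity
  nlinarith

theorem aux_dyn {m : ℕ} (A P : Matrix (Fin m) (Fin m) ℝ) (hP : P.PosDef)
    (g : (Fin m → ℝ) → Fin m → ℝ) (c p2 : ℝ) (hc : 0 < c) (hp2 : 0 < p2)
    (hg : ∀ e, e ⬝ᵥ (Aᵀ * P + P * A).mulVec e - 2 * (e ⬝ᵥ P.mulVec (g e)) ≤ -c * (e ⬝ᵥ e))
    (hup : ∀ e : Fin m → ℝ, e ⬝ᵥ P.mulVec e ≤ p2 * (e ⬝ᵥ e))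
    (l : Fin m) (e : ℝ → Fin m → ℝ) (Δ : ℝ → ℝ) (D : ℝ) (hD : ∀ t, 0 ≤ t → |Δ t| ≤ D)
    (ε : ℝ) (hε : 0 < ε)
    (he : ∀ t, 0 ≤ t → ∀ i, HasDerivAt (fun s => e s i)
      (ε⁻¹ * ((A.mulVec (e t)) i - g (e t) i) + (if i = l then Δ t else 0)) t) :
    ∀ t, 0 ≤ t → e t ⬝ᵥ P.mulVec (e t) ≤
      (e 0 ⬝ᵥ P.mulVec (e 0)) * Real.exp (-((c / (2 * p2) / ε) * t))
        + (2 * ε / c * D ^ 2 * (P l ⬝ᵥ P l)) / (c / (2 * p2) / ε) := by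
  have hsym : Pᵀ = P := by
    have := hP.isHermitian.eq
    rwa [Matrix.conjTranspose_eq_transpose_of_trivial] at this
  have hsym2 : ∀ v w : Fin m → ℝ, v ⬝ᵥ P.mulVec w = w ⬝ᵥ P.mulVec v := by
    intro v w
    rw [Matrix.dotProduct_mulVec, ← Matrix.mulVec_transpose, hsym, dotProduct_comm]
  set e' : ℝ → Fin m → ℝ := fun t i =>
    ε⁻¹ * ((A.mulVec (e t)) i - g (e t) i) + (if i = l then Δ t else 0) with he'
  have hVd : ∀ t, 0 ≤ t → HasDerivAt (fun s => e s ⬝ᵥ P.mulVec (e s))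
      (2 * (e t ⬝ᵥ P.mulVec (e' t))) t := by
    intro t ht
    have h1 : HasDerivAt (fun s => e s ⬝ᵥ P.mulVec (e s))
        (∑ i, (e' t i * (P.mulVec (e t)) i + e t i * (P.mulVec (e' t)) i)) t := by
      unfold dotProduct Matrix.mulVec dotProduct
      refine HasDerivAt.fun_sum fun i _ => ?_
      refine (he t ht i).mul ?_
      refine HasDerivAt.fun_sum fun j _ => ?_
      exact (he t ht j).const_mul _
    convert h1 using 1
    rw [Finset.sum_add_distrib]
    change 2 * _ = (e' t ⬝ᵥ P.mulVec (e t)) + (e t ⬝ᵥ P.mulVec (e' t))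
    rw [hsym2 (e' t)]; ring
  refine aux_gronwall _ _ _ _ (by positivity) hVd ?_ ?_
  · intro t ht
    have hdec : e' t = ε⁻¹ • (A.mulVec (e t) - g (e t)) + Pi.single l (Δ t) := by
      funext i
      simp [he', Pi.single_apply]
    have hlast : e t ⬝ᵥ P.mulVec (Pi.single l (Δ t)) = Δ t * (P l ⬝ᵥ e t) := by
      rw [hsym2, single_dotProduct]; rfl
    have hA : e t ⬝ᵥ (Aᵀ * P + P * A).mulVec (e t) = 2 * (e t ⬝ᵥ P.mulVec (A.mulVec (e t))) := by
      rw [Matrix.add_mulVec, dotProduct_add, ← Matrix.mulVec_mulVec, ← Matrix.mulVec_mulVec,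
        Matrix.dotProduct_mulVec (e t) Aᵀ, Matrix.vecMul_transpose, hsym2 (A.mulVec (e t))]
      ring
    have hgt := hg (e t)
    rw [hA] at hgt
    rw [hdec, Matrix.mulVec_add, dotProduct_add, hlast, Matrix.mulVec_smul, dotProduct_smul,
      Matrix.mulVec_sub, dotProduct_sub, smul_eq_mul]
    have hcs : (P l ⬝ᵥ e t) ^ 2 ≤ (P l ⬝ᵥ P l) * (e t ⬝ᵥ e t) := by
      have := Finset.sum_mul_sq_le_sq_mul_sq Finset.univ (P l) (e t)
      simpa [dotProduct, pow_two] using this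
    have hq0 : 0 ≤ P l ⬝ᵥ P l := Finset.sum_nonneg (fun j _ => mul_self_nonneg _)
    have hE0 : 0 ≤ e t ⬝ᵥ e t := Finset.sum_nonneg (fun j _ => mul_self_nonneg _)
    have hΔ2 : (Δ t) ^ 2 ≤ D ^ 2 := sq_le_sq' (abs_le.mp (hD t ht)).1 (abs_le.mp (hD t ht)).2
    have hu := hup (e t)
    generalize e t ⬝ᵥ e t = E at *
    generalize P l ⬝ᵥ P l = Q at *
    generalize P l ⬝ᵥ e t = y at *
    generalize e t ⬝ᵥ P.mulVec (e t) = V at *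
    generalize e t ⬝ᵥ P.mulVec (A.mulVec (e t)) = a1 at *
    generalize e t ⬝ᵥ P.mulVec (g (e t)) = a2 at *
    generalize Δ t = d at *
    have h1 : 2 * (ε⁻¹ * (a1 - a2)) ≤ -(c / ε) * E := by
      have := mul_le_mul_of_nonneg_left hgt (inv_nonneg.mpr hε.le)
      calc _ = ε⁻¹ * (2 * a1 - 2 * a2) := by ring
        _ ≤ _ := this
        _ = _ := by ring
    have h2 : c / (2 * p2) / ε * V ≤ c / (2 * ε) * E := by
      calc _ ≤ c / (2 * p2) / ε * (p2 * E) := by gcongr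
        _ = _ := by field_simp
    have h3 : 2 * (d * y) ≤ c / (2 * ε) * E + 2 * ε / c * D ^ 2 * Q := by
      have hy : (d * y) ^ 2 ≤ D ^ 2 * (Q * E) := by
        rw [mul_pow]; gcongr
      have hX : 0 ≤ c / (2 * ε) * E := by positivity
      have hY : 0 ≤ 2 * ε / c * D ^ 2 * Q := by positivity
      have hXY : (c / (2 * ε) * E) * (2 * ε / c * D ^ 2 * Q) = D ^ 2 * (Q * E) := by
        field_simp
      apply le_of_abs_le; refine abs_le_of_sq_le_sq ?_ (add_nonneg hX hY)
      nlinarith [sq_nonneg (c / (2 * ε) * E - 2 * ε / c * D ^ 2 * Q)]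
    have h4 : c / ε * E = c / (2 * ε) * E + c / (2 * ε) * E := by field_simp; ring
    nlinarith
  · have hq0 : 0 ≤ P l ⬝ᵥ P l := Finset.sum_nonneg (fun j _ => mul_self_nonneg _)
    positivity

def hidVec {p q : ℕ} (σ : ℝ → ℝ) (net : ResNet p q) (x : Fin p → ℝ) : net.NIdx → ℝ :=
  fun j => net.hfun σ ((j.1 : ℕ) + 1) x j.2

theorem aux_Npiw {p q : ℕ} (σ : ℝ → ℝ) (net : ResNet p q) (x : Fin p → ℝ) (a : Fin q) :
    ∑ j, net.Npiw a j * hidVec σ net x j = (net.Wout.mulVec (net.hfun σ (net.Lm + 1) x)) a := by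
  rw [Fintype.sum_sigma, Finset.sum_eq_single (Fin.last net.Lm)]
  · simp only [ResNet.Npiw, Matrix.of_apply, hidVec, Fin.val_last, dif_pos]
    rfl
  · intro l _ hl
    have : ¬ ((l : ℕ) = net.Lm) := fun h => hl (Fin.ext h)
    simp [ResNet.Npiw, this]
  · simp

theorem aux_Nxi {p q : ℕ} (σ : ℝ → ℝ) (net : ResNet p q) {r : ℕ}
    (T : Matrix (Fin p) (Fin r) ℝ) (e : Fin r → ℝ) (j : net.NIdx) :
    σ (∑ i, net.Nxix T j i * e i + ∑ i, net.Nxiw j i * hidVec σ net (T.mulVec e) i)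
      = hidVec σ net (T.mulVec e) j := by
  obtain ⟨⟨l, hl⟩, a⟩ := j
  cases l with
  | zero =>
    have h2 : ∀ i, net.Nxiw ⟨⟨0, hl⟩, a⟩ i = 0 := by
      intro i; simp [ResNet.Nxiw]
    simp only [h2, zero_mul, Finset.sum_const_zero, add_zero]
    change σ _ = σ ((net.W1.mulVec (T.mulVec e)) a)
    rw [Matrix.mulVec_mulVec]
    rfl
  | succ k =>
    have h1 : ∀ i, net.Nxix T ⟨⟨k + 1, hl⟩, a⟩ i = 0 := by
      intro i; simp [ResNet.Nxix]
    simp only [h1, zero_mul, Finset.sum_const_zero, zero_add]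
    rw [Fintype.sum_sigma, Finset.sum_eq_single ⟨k, by omega⟩]
    · simp only [ResNet.Nxiw, Matrix.of_apply, hidVec, dif_pos]
      rfl
    · intro l _ hl'
      have : ¬ ((l : ℕ) = k) := fun h => hl' (Fin.ext h)
      simp [ResNet.Nxiw, this]
    · simp

theorem aux_ct {n : ℕ} (e : Fin (n + 1) → ℝ) :
    (ctilde n).mulVec e = fun _ => e 0 := by
  funext i; simp [ctilde, Matrix.mulVec, dotProduct]

theorem aux_NpiwS {n : ℕ} (nets : Fin (n + 1) → ResNet 1 1)
    (H : (k : Fin (n + 1)) → (nets k).NIdx → ℝ) (i : Fin (n + 1)) :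
    ∑ j, NpiwS nets i j * H j.1 j.2 = ∑ j, (nets i).Npiw 0 j * H i j := by
  rw [Fintype.sum_sigma, Finset.sum_eq_single i]
  · simp only [NpiwS, Matrix.of_apply, dif_pos]
    rfl
  · intro l _ hl
    simp [NpiwS, hl]
  · simp

theorem aux_NxiwS {n : ℕ} (nets : Fin (n + 1) → ResNet 1 1)
    (H : (k : Fin (n + 1)) → (nets k).NIdx → ℝ) (i : Σ k, (nets k).NIdx) :
    ∑ j, NxiwS nets i j * H j.1 j.2 = ∑ j, (nets i.1).Nxiw i.2 j * H i.1 j := by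
  rw [Fintype.sum_sigma, Finset.sum_eq_single i.1]
  · simp only [NxiwS, Matrix.of_apply, dif_pos]
    rfl
  · intro l _ hl
    simp [NxiwS, hl]
  · simp

theorem aux_lmi {n : ℕ} {σ : ℝ → ℝ} (nets : Fin (n + 1) → ResNet 1 1)
    (α β lam : (Σ k, (nets k).NIdx) → ℝ)
    (hsec : ∀ i, SectorBounded σ (α i) (β i))
    (hlam : ∀ i, 0 ≤ lam i)
    (P : Matrix (Fin (n + 1)) (Fin (n + 1)) ℝ) (hP : P.PosDef)
    (hLMI : Matrix.NegDef
      ((RpiS nets (ctilde n))ᵀ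
          * Matrix.fromBlocks ((shiftMat n)ᵀ * P + P * shiftMat n) (-P) (-P) 0
          * RpiS nets (ctilde n)
        + (RxiS nets (ctilde n))ᵀ * (Psi α β)ᵀ * Mmat lam * Psi α β
          * RxiS nets (ctilde n))) :
    ∃ c : ℝ, 0 < c ∧ ∀ e : Fin (n + 1) → ℝ,
      e ⬝ᵥ ((shiftMat n)ᵀ * P + P * shiftMat n).mulVec e
        - 2 * (e ⬝ᵥ P.mulVec (fun i => (nets i).apply σ (fun _ => e 0) 0)) ≤ -c * (e ⬝ᵥ e) := by
  obtain ⟨c, hc, hz⟩ := aux_negdef _ hLMI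
  refine ⟨c, hc, fun e => ?_⟩
  have hsym : Pᵀ = P := by
    have := hP.isHermitian.eq
    rwa [Matrix.conjTranspose_eq_transpose_of_trivial] at this
  have hsym2 : ∀ v w : Fin (n + 1) → ℝ, v ⬝ᵥ P.mulVec w = w ⬝ᵥ P.mulVec v := by
    intro v w
    rw [Matrix.dotProduct_mulVec, ← Matrix.mulVec_transpose, hsym, dotProduct_comm]
  set g : Fin (n + 1) → ℝ := fun i => (nets i).apply σ (fun _ => e 0) 0 with hg
  set H : (k : Fin (n + 1)) → (nets k).NIdx → ℝ := fun k => hidVec σ (nets k) (fun _ => e 0) with hH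
  set wv : (Σ k, (nets k).NIdx) → ℝ := fun j => H j.1 j.2 with hwv
  set v : (Σ k, (nets k).NIdx) → ℝ :=
    (NxixS nets (ctilde n)).mulVec e + (NxiwS nets).mulVec wv with hv
  have hpi : (RpiS nets (ctilde n)).mulVec (Sum.elim e wv) = Sum.elim e g := by
    rw [RpiS, Matrix.fromBlocks_mulVec]
    simp only [Sum.elim_comp_inl, Sum.elim_comp_inr, Matrix.one_mulVec, Matrix.zero_mulVec, add_zero]
    congr 1
    funext i
    simp only [Pi.add_apply, hg, ResNet.apply]
    rw [add_comm]
    congr 1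
    · rw [← aux_Npiw]
      exact aux_NpiwS nets H i
    · rw [← aux_ct e, Matrix.mulVec_mulVec]
      rfl
  have hxi : (RxiS nets (ctilde n)).mulVec (Sum.elim e wv) = Sum.elim v wv := by
    rw [RxiS, Matrix.fromBlocks_mulVec]
    simp only [Sum.elim_comp_inl, Sum.elim_comp_inr, Matrix.one_mulVec, Matrix.zero_mulVec, zero_add, hv]
  have hvw : ∀ j, wv j = σ (v j) := by
    intro j
    have h1 := aux_Nxi σ (nets j.1) (ctilde n) e j.2
    rw [aux_ct] at h1
    rw [hwv]
    simp only [hH]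
    rw [← h1]
    congr 1
    simp only [hv, Pi.add_apply]
    congr 1
    exact (aux_NxiwS nets H j).symm
  have hq := hz (Sum.elim e wv)
  have hpsi : (Psi α β).mulVec (Sum.elim v wv) =
      Sum.elim (fun j => β j * v j - wv j) (fun j => wv j - α j * v j) := by
    rw [Psi, Matrix.fromBlocks_mulVec]
    simp only [Sum.elim_comp_inl, Sum.elim_comp_inr, Matrix.one_mulVec, Matrix.neg_mulVec]
    congr 1
    · funext j; simp [Matrix.mulVec_diagonal]; ring
    · funext j; simp [Matrix.mulVec_diagonal]; ring
  have hM : 0 ≤ (Psi α β).mulVec (Sum.elim v wv) ⬝ᵥ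
      (Mmat lam).mulVec ((Psi α β).mulVec (Sum.elim v wv)) := by
    rw [hpsi, Mmat, Matrix.fromBlocks_mulVec]
    simp only [Sum.elim_comp_inl, Sum.elim_comp_inr, Matrix.zero_mulVec, zero_add, add_zero]
    rw [sumElim_dotProduct_sumElim]
    refine add_nonneg (Finset.sum_nonneg fun j _ => ?_) (Finset.sum_nonneg fun j _ => ?_)
    all_goals
      rw [Matrix.mulVec_diagonal]
      have h1 := hsec j (v j)
      rw [← hvw] at h1
      have h2 := mul_nonneg (hlam j) h1
      nlinarith
  have hN : Sum.elim e g ⬝ᵥ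
      (Matrix.fromBlocks ((shiftMat n)ᵀ * P + P * shiftMat n) (-P) (-P) 0).mulVec (Sum.elim e g)
      = e ⬝ᵥ ((shiftMat n)ᵀ * P + P * shiftMat n).mulVec e - 2 * (e ⬝ᵥ P.mulVec g) := by
    rw [Matrix.fromBlocks_mulVec]
    simp only [Sum.elim_comp_inl, Sum.elim_comp_inr, Matrix.zero_mulVec, add_zero, Matrix.neg_mulVec]
    rw [sumElim_dotProduct_sumElim, dotProduct_add, dotProduct_neg, dotProduct_neg, hsym2 g e]
    ring
  rw [Matrix.add_mulVec, dotProduct_add] at hq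
  simp only [← Matrix.mulVec_mulVec] at hq
  rw [hpi, hxi, Matrix.dotProduct_mulVec _ (RpiS nets (ctilde n))ᵀ, Matrix.vecMul_transpose, hpi, hN,
    Matrix.dotProduct_mulVec _ (RxiS nets (ctilde n))ᵀ, Matrix.vecMul_transpose, hxi,
    Matrix.dotProduct_mulVec _ (Psi α β)ᵀ, Matrix.vecMul_transpose] at hq
  rw [sumElim_dotProduct_sumElim] at hq
  have hw0 : 0 ≤ wv ⬝ᵥ wv := Finset.sum_nonneg (fun j _ => mul_self_nonneg _)
  nlinarith

theorem aux_norm2 {I : Type*} [Fintype I] (v : I → ℝ) : ‖v‖ ≤ norm2 v := by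
  unfold norm2
  rw [pi_norm_le_iff_of_nonneg (Real.sqrt_nonneg _)]
  intro i
  rw [Real.norm_eq_abs]
  apply Real.abs_le_sqrt
  exact Finset.single_le_sum (f := fun i => v i ^ 2) (fun j _ => sq_nonneg _) (Finset.mem_univ i)

theorem aux_F {n nd : ℕ} (b : ℝ)
    (F : ℝ × (Fin n → ℝ) × (Fin nd → ℝ) → ℝ) (hF : ContDiff ℝ 1 F)
    (χ : (Fin n → ℝ) × (Fin nd → ℝ) → ℝ) (hχ : Continuous χ)
    (hFbd : ∀ (t : ℝ) (xv : Fin n → ℝ) (wv : Fin nd → ℝ),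
      |F (t, xv, wv)| ≤ χ (xv, wv) ∧ ‖fderiv ℝ F (t, xv, wv)‖ ≤ χ (xv, wv))
    (w : ℝ → Fin nd → ℝ) (hw : ContDiff ℝ 1 w)
    (Mw : ℝ) (hMw : ∀ t : ℝ, 0 ≤ t → norm2 (w t) + norm2 (deriv w t) ≤ Mw)
    (u : ℝ → ℝ) (x : ℝ → Fin n → ℝ)
    (hx : ∀ t : ℝ, 0 ≤ t → ∀ i : Fin n, HasDerivAt (fun s => x s i)
      (if h : (i : ℕ) + 1 < n then x t ⟨(i : ℕ) + 1, h⟩ else F (t, x t, w t) + b * u t) t)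
    (Mu : ℝ) (hMu : ∀ t : ℝ, 0 ≤ t → norm2 (x t) + |u t| ≤ Mu) :
    ∃ (D : ℝ) (Δ : ℝ → ℝ), (∀ t, 0 ≤ t → |Δ t| ≤ D) ∧
      ∀ t, 0 ≤ t → HasDerivAt (fun s => F (s, x s, w s)) (Δ t) t := by
  have hcomp : IsCompact (Metric.closedBall (0 : Fin n → ℝ) Mu ×ˢ Metric.closedBall (0 : Fin nd → ℝ) Mw) :=
    (isCompact_closedBall _ _).prod (isCompact_closedBall _ _)
  obtain ⟨C, hC⟩ := hcomp.bddAbove_image hχ.continuousOn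
  have hn2 : ∀ {I : Type} [Fintype I] (v : I → ℝ), 0 ≤ norm2 v := fun v => Real.sqrt_nonneg _
  have hxb : ∀ t, 0 ≤ t → ‖x t‖ ≤ Mu := fun t ht => by
    linarith [aux_norm2 (x t), hMu t ht, abs_nonneg (u t)]
  have hub : ∀ t, 0 ≤ t → |u t| ≤ Mu := fun t ht => by
    linarith [hn2 (x t), hMu t ht]
  have hwb : ∀ t, 0 ≤ t → ‖w t‖ ≤ Mw := fun t ht => by
    linarith [aux_norm2 (w t), hMw t ht, hn2 (deriv w t)]
  have hwb' : ∀ t, 0 ≤ t → ‖deriv w t‖ ≤ Mw := fun t ht => by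
    linarith [aux_norm2 (deriv w t), hMw t ht, hn2 (w t)]
  have hχb : ∀ t, 0 ≤ t → χ (x t, w t) ≤ C := fun t ht =>
    hC ⟨(x t, w t), ⟨mem_closedBall_zero_iff.mpr (hxb t ht), mem_closedBall_zero_iff.mpr (hwb t ht)⟩, rfl⟩
  set x' : ℝ → Fin n → ℝ := fun t i =>
    if h : (i : ℕ) + 1 < n then x t ⟨(i : ℕ) + 1, h⟩ else F (t, x t, w t) + b * u t with hx'
  have hMu0 : 0 ≤ Mu := (norm_nonneg _).trans (hxb 0 le_rfl)
  have hMw0 : 0 ≤ Mw := (norm_nonneg _).trans (hwb 0 le_rfl)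
  have hC0 : 0 ≤ C := ((abs_nonneg _).trans (hFbd 0 (x 0) (w 0)).1).trans (hχb 0 le_rfl)
  have hx'b : ∀ t, 0 ≤ t → ‖x' t‖ ≤ Mu + C + |b| * Mu := by
    intro t ht
    rw [pi_norm_le_iff_of_nonneg (by positivity)]
    intro i
    simp only [hx']
    split_ifs with h
    · have := (norm_le_pi_norm (x t) ⟨(i : ℕ) + 1, h⟩).trans (hxb t ht)
      have : 0 ≤ |b| * Mu := by positivity
      linarith
    · have h1 := ((hFbd t (x t) (w t)).1).trans (hχb t ht)
      have h2 : |b * u t| ≤ |b| * Mu := by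
        rw [abs_mul]; exact mul_le_mul_of_nonneg_left (hub t ht) (abs_nonneg _)
      rw [Real.norm_eq_abs]
      linarith [abs_add_le (F (t, x t, w t)) (b * u t)]
  refine ⟨C * (1 + (Mu + C + |b| * Mu) + Mw), fun t => fderiv ℝ F (t, x t, w t) (1, x' t, deriv w t), ?_, ?_⟩
  · intro t ht
    rw [← Real.norm_eq_abs]
    refine (ContinuousLinearMap.le_opNorm _ _).trans ?_
    have h1 := ((hFbd t (x t) (w t)).2).trans (hχb t ht)
    have h0 : 0 ≤ |b| * Mu := by positivity
    refine mul_le_mul h1 ?_ (norm_nonneg _) hC0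
    rw [Prod.norm_def, Prod.norm_def]
    simp only [norm_one]
    have := hx'b t ht
    have := hwb' t ht
    refine max_le (by linarith) (max_le (by linarith) (by linarith))
  · intro t ht
    have h1 : HasDerivAt x (x' t) t := hasDerivAt_pi.mpr (hx t ht)
    have h2 : HasDerivAt w (deriv w t) t := (hw.differentiable one_ne_zero t).hasDerivAt
    have h3 := (hF.differentiable one_ne_zero (t, x t, w t)).hasFDerivAt
    exact h3.comp_hasDerivAt t ((hasDerivAt_id t).prodMk (h1.prodMk h2))

theorem aux_eps (n : ℕ) (A B k T η : ℝ) (hk : 0 < k) (hT : 0 < T) (hη : 0 < η) :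
    ∃ ε₀ : ℝ, 0 < ε₀ ∧ ε₀ ≤ 1 ∧ ∀ ε, 0 < ε → ε < ε₀ →
      A * ((ε⁻¹) ^ (2 * n) * Real.exp (-(k / ε * T))) + B * ε ^ 2 < η := by
  have h1 : Filter.Tendsto (fun ε : ℝ => A * ((ε⁻¹) ^ (2 * n) * Real.exp (-(k / ε * T))) + B * ε ^ 2)
      (nhdsWithin 0 (Set.Ioi 0)) (nhds (A * 0 + B * 0 ^ 2)) := by
    refine Filter.Tendsto.add (Filter.Tendsto.const_mul _ ?_) (Filter.Tendsto.const_mul _ ?_)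
    · have := (tendsto_rpow_mul_exp_neg_mul_atTop_nhds_zero ((2 * n : ℕ) : ℝ) (k * T) (by positivity)).comp
        (tendsto_inv_nhdsGT_zero (𝕜 := ℝ))
      refine this.congr fun ε => ?_
      simp only [Function.comp, Real.rpow_natCast]
      congr 2
      ring
    · exact ((continuous_pow 2).tendsto (0 : ℝ)).mono_left nhdsWithin_le_nhds
  simp only [mul_zero, ne_eq, OfNat.ofNat_ne_zero, not_false_eq_true, zero_pow, add_zero] at h1
  have h2 := h1.eventually (gt_mem_nhds hη)
  rw [Filter.Eventually, mem_nhdsGT_iff_exists_Ioo_subset] at h2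
  obtain ⟨r, hr, hsub⟩ := h2
  refine ⟨min r 1, lt_min hr one_pos, min_le_right _ _, fun ε h0 h1 => hsub ⟨h0, h1.trans_le (min_le_left _ _)⟩⟩

/-- Theorem 3 (ii): recovery of the extended state for the integrator chain.  Under the same
hypotheses as Theorem 3 (i), the extended state (the total uncertainty `F(t, x, w)`) is
recovered by the last observer component `x̂_{n+1}` uniformly on `[T, ∞)` as `ε → 0⁺`. -/
theorem integrator_chain_uncertainty_recovered
    {n nd : ℕ} (hn : 1 ≤ n) (b : ℝ)
    {σ : ℝ → ℝ} (hσ0 : σ 0 = 0)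
    (F : ℝ × (Fin n → ℝ) × (Fin nd → ℝ) → ℝ) (hF : ContDiff ℝ 1 F)
    (χ : (Fin n → ℝ) × (Fin nd → ℝ) → ℝ) (hχ : Continuous χ)
    (hFbd : ∀ (t : ℝ) (xv : Fin n → ℝ) (wv : Fin nd → ℝ),
      |F (t, xv, wv)| ≤ χ (xv, wv) ∧ ‖fderiv ℝ F (t, xv, wv)‖ ≤ χ (xv, wv))
    (w : ℝ → Fin nd → ℝ) (hw : ContDiff ℝ 1 w)
    (Mw : ℝ) (hMw : ∀ t : ℝ, 0 ≤ t → norm2 (w t) + norm2 (deriv w t) ≤ Mw)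
    (u : ℝ → ℝ) (x : ℝ → Fin n → ℝ)
    (hx : ∀ t : ℝ, 0 ≤ t → ∀ i : Fin n, HasDerivAt (fun s => x s i)
      (if h : (i : ℕ) + 1 < n then x t ⟨(i : ℕ) + 1, h⟩ else F (t, x t, w t) + b * u t) t)
    (Mu : ℝ) (hMu : ∀ t : ℝ, 0 ≤ t → norm2 (x t) + |u t| ≤ Mu)
    (nets : Fin (n + 1) → ResNet 1 1)
    (α β lam : (Σ k, (nets k).NIdx) → ℝ)
    (hαβ : ∀ i, α i ≤ β i) (hsec : ∀ i, SectorBounded σ (α i) (β i))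
    (hlam : ∀ i, 0 ≤ lam i)
    (P : Matrix (Fin (n + 1)) (Fin (n + 1)) ℝ) (hP : P.PosDef)
    (hLMI : Matrix.NegDef
      ((RpiS nets (ctilde n))ᵀ
          * Matrix.fromBlocks ((shiftMat n)ᵀ * P + P * shiftMat n) (-P) (-P) 0
          * RpiS nets (ctilde n)
        + (RxiS nets (ctilde n))ᵀ * (Psi α β)ᵀ * Mmat lam * Psi α β
          * RxiS nets (ctilde n)))
    (xh0 : Fin (n + 1) → ℝ) :
    ∀ T δ : ℝ, 0 < T → 0 < δ → ∃ ε₀ : ℝ, 0 < ε₀ ∧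
      ∀ ε : ℝ, 0 < ε → ε < ε₀ →
        ∀ xh : ℝ → Fin (n + 1) → ℝ, xh 0 = xh0 →
          (∀ t : ℝ, 0 ≤ t → ∀ i : Fin (n + 1), HasDerivAt (fun s => xh s i)
            (if _ : (i : ℕ) < n then
              xh t ⟨(i : ℕ) + 1, by omega⟩
                + ε ^ (n - 1 - (i : ℕ))
                  * ((nets i).apply σ (fun _ => (x t ⟨0, hn⟩ - xh t 0) / ε ^ n) 0)
                + (if (i : ℕ) = n - 1 then b * u t else 0)
            else
              ε⁻¹ * ((nets i).apply σ (fun _ => (x t ⟨0, hn⟩ - xh t 0) / ε ^ n) 0)) t) →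
          ∀ t : ℝ, T ≤ t →
            |F (t, x t, w t) - xh t (Fin.last n)| ≤ δ := by
  obtain ⟨D, Δ, hD, hΔ⟩ := aux_F b F hF χ hχ hFbd w hw Mw hMw u x hx Mu hMu
  obtain ⟨c, hc, hg⟩ := aux_lmi nets α β lam hsec hlam P hP hLMI
  obtain ⟨p2, hp2, hup⟩ := aux_upper P
  obtain ⟨p1, hp1, hlow⟩ : ∃ c : ℝ, 0 < c ∧ ∀ z : Fin (n + 1) → ℝ, c * (z ⬝ᵥ z) ≤ z ⬝ᵥ P.mulVec z := by
    obtain ⟨c, hc, h⟩ := aux_negdef (-P) (by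
      intro z hz
      have := hP.dotProduct_mulVec_pos hz
      simp only [star_trivial] at this
      rw [Matrix.neg_mulVec, dotProduct_neg]
      linarith)
    refine ⟨c, hc, fun z => ?_⟩
    have := h z
    rw [Matrix.neg_mulVec, dotProduct_neg] at this
    linarith
  intro T δ hT hδ
  set X : ℝ → Fin (n + 1) → ℝ := fun t i =>
    if h : (i : ℕ) < n then x t ⟨i, h⟩ else F (t, x t, w t) with hX
  set a : Fin (n + 1) → ℝ := fun i => X 0 i - xh0 i with ha
  set k := c / (2 * p2) with hk
  have hk0 : 0 < k := by positivity
  obtain ⟨ε₀, hε₀, hε₁, hεb⟩ := aux_eps n (p2 * (a ⬝ᵥ a))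
    (2 / c * D ^ 2 * (P (Fin.last n) ⬝ᵥ P (Fin.last n)) / k) k T (p1 * δ ^ 2) hk0 hT (by positivity)
  refine ⟨ε₀, hε₀, fun ε hε hεε xh hxh0 hxh t ht => ?_⟩
  have hεle : ε ≤ 1 := (hεε.trans_le hε₁).le
  set e : ℝ → Fin (n + 1) → ℝ := fun t i => (X t i - xh t i) / ε ^ (n - (i : ℕ)) with he
  have hXd : ∀ t, 0 ≤ t → ∀ i : Fin (n + 1), HasDerivAt (fun s => X s i)
      (if h : (i : ℕ) < n then X t ⟨(i : ℕ) + 1, by omega⟩ + (if (i : ℕ) = n - 1 then b * u t else 0)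
        else Δ t) t := by
    intro t ht i
    by_cases hi : (i : ℕ) < n
    · simp only [hX, hi, dif_pos]
      have h1 := hx t ht ⟨i, hi⟩
      by_cases hi2 : (i : ℕ) + 1 < n
      · have : ¬ ((i : ℕ) = n - 1) := by omega
        simp only [hi2, dif_pos] at h1
        simpa [hi2, this] using h1
      · have : (i : ℕ) = n - 1 := by omega
        simp only [hi2, dif_neg, not_false_eq_true] at h1
        simp only [hi2, dif_neg, not_false_eq_true, if_pos this]
        exact h1
    · simp only [hX, hi, dif_neg, not_false_eq_true]
      exact hΔ t ht
  have hed : ∀ t, 0 ≤ t → ∀ i, HasDerivAt (fun s => e s i)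
      (ε⁻¹ * (((shiftMat n).mulVec (e t)) i - (fun i => (nets i).apply σ (fun _ => e t 0) 0) i)
        + (if i = Fin.last n then Δ t else 0)) t := by
    intro t ht i
    have he0 : e t 0 = (x t ⟨0, hn⟩ - xh t 0) / ε ^ n := by
      have : 0 < n := hn
      simp [he, hX, this]
    have h1 := ((hXd t ht i).sub (hxh t ht i)).div_const (ε ^ (n - (i : ℕ)))
    rw [← he0] at h1
    refine h1.congr_deriv ?_
    by_cases hi : (i : ℕ) < n
    · have hne : i ≠ Fin.last n := by
        intro h; rw [h] at hi; simp at hi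
      have hsh : ((shiftMat n).mulVec (e t)) i = e t ⟨(i : ℕ) + 1, by omega⟩ := by
        simp only [Matrix.mulVec, dotProduct, shiftMat, Matrix.of_apply]
        rw [Finset.sum_eq_single ⟨(i : ℕ) + 1, by omega⟩]
        · simp
        · intro j _ hj
          have : ¬ ((i : ℕ) + 1 = (j : ℕ)) := fun h => hj (Fin.ext h.symm)
          simp [this]
        · simp
      rw [hsh]
      simp only [hi, dif_pos, if_neg hne, add_zero, he]
      obtain ⟨m, hm⟩ : ∃ m, n = (i : ℕ) + 1 + m := ⟨n - (i + 1), by omega⟩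
      have e1 : n - 1 - (i : ℕ) = m := by omega
      have e2 : n - (i : ℕ) = m + 1 := by omega
      have e3 : n - ((i : ℕ) + 1) = m := by omega
      rw [e1, e2, e3]
      field_simp
      ring
    · have hl : i = Fin.last n := Fin.ext (by simp; omega)
      have hsh : ((shiftMat n).mulVec (e t)) i = 0 := by
        simp only [Matrix.mulVec, dotProduct, shiftMat, Matrix.of_apply]
        refine Finset.sum_eq_zero fun j _ => ?_
        have : ¬ ((i : ℕ) + 1 = (j : ℕ)) := by omega
        simp [this]
      rw [hsh]
      simp only [hi, dif_neg, not_false_eq_true, if_pos hl]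
      have e2 : n - (i : ℕ) = 0 := by omega
      rw [e2]
      simp
      ring
  have hmain := aux_dyn (shiftMat n) P hP (fun e i => (nets i).apply σ (fun _ => e 0) 0) c p2 hc hp2
    hg hup (Fin.last n) e Δ D hD ε hε hed t (hT.le.trans ht)
  have hE0 : e 0 ⬝ᵥ e 0 ≤ (ε⁻¹) ^ (2 * n) * (a ⬝ᵥ a) := by
    simp only [dotProduct, Finset.mul_sum]
    refine Finset.sum_le_sum fun i _ => ?_
    have h1 : e 0 i = (ε⁻¹) ^ (n - (i : ℕ)) * a i := by
      simp only [he, ha, hxh0, inv_pow]; ring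
    rw [h1]
    have h2 : (ε⁻¹) ^ (n - (i : ℕ)) ≤ (ε⁻¹) ^ n :=
      pow_le_pow_right₀ (one_le_inv₀ hε |>.mpr hεle) (Nat.sub_le _ _)
    have h3 : 0 ≤ (ε⁻¹) ^ (n - (i : ℕ)) := by positivity
    calc _ = ((ε⁻¹) ^ (n - (i : ℕ)) * (ε⁻¹) ^ (n - (i : ℕ))) * (a i * a i) := by ring
      _ ≤ ((ε⁻¹) ^ n * (ε⁻¹) ^ n) * (a i * a i) :=
        mul_le_mul_of_nonneg_right (mul_le_mul h2 h2 h3 (h3.trans h2)) (mul_self_nonneg _)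
      _ = _ := by ring
  have hexp : Real.exp (-(k / ε * t)) ≤ Real.exp (-(k / ε * T)) := by
    apply Real.exp_le_exp.mpr
    have : k / ε * T ≤ k / ε * t := mul_le_mul_of_nonneg_left ht (by positivity)
    linarith
  have hV0 : e 0 ⬝ᵥ P.mulVec (e 0) ≤ p2 * ((ε⁻¹) ^ (2 * n) * (a ⬝ᵥ a)) :=
    (hup _).trans (mul_le_mul_of_nonneg_left hE0 hp2.le)
  have haa : 0 ≤ a ⬝ᵥ a := Finset.sum_nonneg (fun j _ => mul_self_nonneg _)
  have hfin : (e 0 ⬝ᵥ P.mulVec (e 0)) * Real.exp (-(k / ε * t)) ≤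
      p2 * ((ε⁻¹) ^ (2 * n) * (a ⬝ᵥ a)) * Real.exp (-(k / ε * T)) :=
    mul_le_mul hV0 hexp (Real.exp_pos _).le (by positivity)
  have hb := hεb ε hε hεε
  have hlast : e t (Fin.last n) = F (t, x t, w t) - xh t (Fin.last n) := by
    simp [he, hX]
  have hsq : e t (Fin.last n) * e t (Fin.last n) ≤ e t ⬝ᵥ e t :=
    Finset.single_le_sum (f := fun i => e t i * e t i) (fun j _ => mul_self_nonneg _)
      (Finset.mem_univ _)
  have hV := hlow (e t)
  rw [← hlast]
  have hterm : (2 * ε / c * D ^ 2 * (P (Fin.last n) ⬝ᵥ P (Fin.last n))) / (k / ε)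
      = 2 / c * D ^ 2 * (P (Fin.last n) ⬝ᵥ P (Fin.last n)) / k * ε ^ 2 := by
    field_simp
  rw [hterm] at hmain
  have hlt : p1 * (e t (Fin.last n)) ^ 2 ≤ p1 * δ ^ 2 := by
    have h5 := mul_le_mul_of_nonneg_left hsq hp1.le
    rw [pow_two (e t (Fin.last n))]
    have h6 : p2 * ((ε⁻¹) ^ (2 * n) * (a ⬝ᵥ a)) * Real.exp (-(k / ε * T))
      = p2 * (a ⬝ᵥ a) * ((ε⁻¹) ^ (2 * n) * Real.exp (-(k / ε * T))) := by ring
    linarith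
  exact abs_le_of_sq_le_sq (le_of_mul_le_mul_left hlt hp1) hδ.le
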